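/- Let X be a CAT(0) geodesic metric space and Δ(a,b,c) a geodesic triangle in X. Let d be a point on the geodesic segment from a to b. Suppose the triangles Δ(a,d,c) and Δ(b,d,c) are both Euclidean (their convex hulls are isometric to the convex hulls of triangles in Euclidean space), and suppose the Alexandrov angles at d satisfy ∠_d(da, dc) + ∠_d(db, dc) = π. Then the triangle Δ(a,b,c) is Euclidean. -/

import Mathlib

open Real Set Metric

noncomputable section

/-- `γ` restricted to the parameter set `s` is an isometric (unit-speed) embedding. -/
def IsGeodesicOn {X : Type*} [MetricSpace X] (γ : ℝ → X) (s : Set ℝ) : Prop :=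
  ∀ a ∈ s, ∀ b ∈ s, dist (γ a) (γ b) = |a - b|

/-- A geodesic segment parametrized on `[a,b]` from `x` to `y`. -/
def IsGeodesicSeg {X : Type*} [MetricSpace X] (γ : ℝ → X) (a b : ℝ) (x y : X) : Prop :=
  IsGeodesicOn γ (Set.Icc a b) ∧ γ a = x ∧ γ b = y

/-- A local geodesic parametrized on `[a,b]`. -/
def IsLocalGeodesic {X : Type*} [MetricSpace X] (γ : ℝ → X) (a b : ℝ) : Prop :=
  ∀ t ∈ Set.Icc a b, ∃ ε > 0, IsGeodesicOn γ (Set.Icc (t - ε) (t + ε) ∩ Set.Icc a b)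

/-- Any two points are joined by a geodesic. -/
def GeodesicSpace (X : Type*) [MetricSpace X] : Prop :=
  ∀ x y : X, ∃ γ : ℝ → X, IsGeodesicSeg γ 0 (dist x y) x y

/-- The distance in the unit 2-sphere from the vertex `P̄` of a spherical comparison
triangle with side lengths `a = d(Q,R)`, `b = d(R,P)`, `c = d(P,Q)` to the point at
arclength `t` along the side `Q̄R̄` (spherical law of cosines). -/
def sphCompDist (a b c t : ℝ) : ℝ :=
  Real.arccos (Real.cos c * Real.cos t +
    Real.sin c * Real.sin t *
      ((Real.cos b - Real.cos a * Real.cos c) / (Real.sin a * Real.sin c)))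

/-- CAT(1): distances < π are realized by geodesics, and geodesic triangles of
perimeter < 2π are at least as thin as their comparison triangles in the unit sphere. -/
def IsCAT1 (X : Type*) [MetricSpace X] : Prop :=
  (∀ x y : X, dist x y < π → ∃ γ : ℝ → X, IsGeodesicSeg γ 0 (dist x y) x y) ∧
  ∀ (p q r : X) (γ : ℝ → X), IsGeodesicSeg γ 0 (dist q r) q r →
    dist p q + dist q r + dist r p < 2 * π →
    ∀ t ∈ Set.Icc (0:ℝ) (dist q r),
      dist p (γ t) ≤ sphCompDist (dist q r) (dist r p) (dist p q) t

/-- CAT(0): geodesic space satisfying the CN (midpoint) comparison inequality. -/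
def IsCAT0 (X : Type*) [MetricSpace X] : Prop :=
  GeodesicSpace X ∧
  ∀ p q r m : X, dist q m = dist q r / 2 → dist m r = dist q r / 2 →
    dist p m ^ 2 ≤ (dist p q ^ 2 + dist p r ^ 2) / 2 - dist q r ^ 2 / 4

/-- Euclidean comparison angle at `x` of the points `p`, `q`. -/
def compAngle {X : Type*} [MetricSpace X] (x p q : X) : ℝ :=
  Real.arccos ((dist x p ^ 2 + dist x q ^ 2 - dist p q ^ 2) / (2 * dist x p * dist x q))

/-- The Alexandrov (upper) angle at `x` between two curves `γ`, `σ` emanating from `x`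
(parametrized with `γ 0 = σ 0 = x`). -/
def alexAngle {X : Type*} [MetricSpace X] (x : X) (γ σ : ℝ → X) : ℝ :=
  ⨅ ε : {ε : ℝ // 0 < ε}, ⨆ s ∈ Set.Ioc (0:ℝ) ε.1, ⨆ t ∈ Set.Ioc (0:ℝ) ε.1,
    compAngle x (γ s) (σ t)

/-- A geodesic triangle with vertices `a b c` is Euclidean (flat) if the convex hull of a
Euclidean triangle with vertices `A B C` embeds isometrically into `X` with `A ↦ a` etc. -/
def FlatTriangle {X : Type*} [MetricSpace X] (a b c : X) : Prop :=
  ∃ (A B C : EuclideanSpace ℝ (Fin 2)) (φ : EuclideanSpace ℝ (Fin 2) → X),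
    (∀ p ∈ convexHull ℝ ({A, B, C} : Set (EuclideanSpace ℝ (Fin 2))),
      ∀ q ∈ convexHull ℝ ({A, B, C} : Set (EuclideanSpace ℝ (Fin 2))),
        dist (φ p) (φ q) = dist p q) ∧
    φ A = a ∧ φ B = b ∧ φ C = c

/-- A bounded-above function on `[0,L]`, midpoint convex with nonpositive end values, is `≤ 0`. -/
lemma midconv_nonpos (f : ℝ → ℝ) (L K : ℝ) (hL : 0 ≤ L)
    (hK : ∀ x ∈ Set.Icc 0 L, f x ≤ K) (h0 : f 0 ≤ 0) (h1 : f L ≤ 0)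
    (hm : ∀ x ∈ Set.Icc 0 L, ∀ y ∈ Set.Icc 0 L, f ((x + y) / 2) ≤ (f x + f y) / 2) :
    ∀ x ∈ Set.Icc 0 L, f x ≤ 0 := by
  set M := sSup (f '' Set.Icc 0 L) with hM
  have hb : BddAbove (f '' Set.Icc 0 L) := ⟨K, by rintro _ ⟨x, hx, rfl⟩; exact hK x hx⟩
  have hle : ∀ x ∈ Set.Icc 0 L, f x ≤ M := fun x hx => le_csSup hb ⟨x, hx, rfl⟩
  have hhalf : ∀ x ∈ Set.Icc 0 L, f x ≤ M / 2 := by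
    intro x hx
    have hx' := hx
    obtain ⟨hx0, hx1⟩ := hx'
    rcases le_total x (L / 2) with h | h
    · have hy : 2 * x ∈ Set.Icc 0 L := ⟨by linarith, by linarith⟩
      have := hm 0 ⟨le_rfl, hL⟩ (2 * x) hy
      rw [show (0 + 2 * x) / 2 = x by ring] at this
      have := hle _ hy
      linarith
    · have hy : 2 * x - L ∈ Set.Icc 0 L := ⟨by linarith, by linarith⟩
      have := hm L ⟨hL, le_rfl⟩ (2 * x - L) hy
      rw [show (L + (2 * x - L)) / 2 = x by ring] at this
      have := hle _ hy
      linarith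
  have hMM : M ≤ M / 2 := by
    refine csSup_le (Set.Nonempty.image f ⟨0, ⟨le_rfl, hL⟩⟩) ?_
    rintro _ ⟨x, hx, rfl⟩
    exact hhalf x hx
  intro x hx
  have := hle x hx
  linarith

/-- Stewart inequality along a geodesic. -/
lemma stewart_geod {X : Type*} [MetricSpace X] (hX : IsCAT0 X) (p q r : X) (γ : ℝ → X)
    (hγ : IsGeodesicSeg γ 0 (dist q r) q r) (t : ℝ) (ht : t ∈ Set.Icc (0:ℝ) 1) :
    dist p (γ (t * dist q r)) ^ 2 ≤
      (1 - t) * dist p q ^ 2 + t * dist p r ^ 2 - t * (1 - t) * dist q r ^ 2 := by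
  obtain ⟨hg, hq, hr⟩ := hγ
  set L := dist q r with hL
  have hL0 : 0 ≤ L := dist_nonneg
  rcases hL0.eq_or_lt with h | hpos
  · have hqr : q = r := dist_eq_zero.1 (hL ▸ h.symm)
    subst hqr
    rw [← h, mul_zero]
    rw [← h] at hr
    rw [hr]
    apply le_of_eq
    ring
  have key := midconv_nonpos (fun x => dist p (γ x) ^ 2 - x ^ 2 - dist p q ^ 2
      - x / L * (dist p r ^ 2 - dist p q ^ 2 - L ^ 2)) L
      ((dist p q + L) ^ 2 + |dist p r ^ 2 - dist p q ^ 2 - L ^ 2|) hL0 ?_ ?_ ?_ ?_ (t * L)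
      ⟨by have := ht.1; positivity, by nlinarith [ht.2]⟩
  · rw [mul_div_assoc, div_self hpos.ne'] at key
    nlinarith
  · intro x hx
    have h1 : dist q (γ x) = x := by
      rw [← hq, hg 0 ⟨le_rfl, hL0⟩ x hx, zero_sub, abs_neg, abs_of_nonneg hx.1]
    have h2 : dist p (γ x) ≤ dist p q + L := by
      have := dist_triangle p q (γ x)
      have := hx.2
      linarith
    have h3 : dist p (γ x) ^ 2 ≤ (dist p q + L) ^ 2 := by gcongr
    have h4 : -(x / L * (dist p r ^ 2 - dist p q ^ 2 - L ^ 2)) ≤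
        |dist p r ^ 2 - dist p q ^ 2 - L ^ 2| := by
      have hxL : x / L ≤ 1 := (div_le_one hpos).2 hx.2
      have hxL0 : 0 ≤ x / L := div_nonneg hx.1 hL0
      have := neg_abs_le (dist p r ^ 2 - dist p q ^ 2 - L ^ 2)
      have := abs_nonneg (dist p r ^ 2 - dist p q ^ 2 - L ^ 2)
      nlinarith
    nlinarith [sq_nonneg x, sq_nonneg (dist p q)]
  · simp [hq]
  · simp only [hr, div_self hpos.ne']
    apply le_of_eq
    ring
  · intro x hx y hy
    have hmI : (x + y) / 2 ∈ Set.Icc 0 L :=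
      ⟨by linarith [hx.1, hy.1], by linarith [hx.2, hy.2]⟩
    have e1 : dist (γ x) (γ y) = |x - y| := hg x hx y hy
    have h := hX.2 p (γ x) (γ y) (γ ((x + y) / 2))
      (by rw [e1, hg x hx _ hmI, show x - (x + y) / 2 = (x - y) / 2 by ring, abs_div, abs_two])
      (by rw [e1, hg _ hmI y hy, show (x + y) / 2 - y = (x - y) / 2 by ring, abs_div, abs_two])
    rw [e1, sq_abs] at h
    have e2 : (x + y) / 2 / L = (x / L + y / L) / 2 := by ring
    rw [e2]
    nlinarith

/-- A point at the right distances from the ends is on every geodesic. -/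
lemma geod_unique {X : Type*} [MetricSpace X] (hX : IsCAT0 X) (q r z : X) (γ : ℝ → X)
    (hγ : IsGeodesicSeg γ 0 (dist q r) q r) (t : ℝ) (ht : t ∈ Set.Icc (0:ℝ) 1)
    (h1 : dist q z = t * dist q r) (h2 : dist z r = (1 - t) * dist q r) :
    z = γ (t * dist q r) := by
  have h := stewart_geod hX z q r γ hγ t ht
  rw [dist_comm z q, h1, h2] at h
  have : dist z (γ (t * dist q r)) ^ 2 ≤ 0 := by nlinarith
  exact dist_eq_zero.1 (pow_eq_zero_iff (two_ne_zero) |>.1 (le_antisymm this (sq_nonneg _)))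

lemma stewart {X : Type*} [MetricSpace X] (hX : IsCAT0 X) (p q r z : X)
    (t : ℝ) (ht : t ∈ Set.Icc (0:ℝ) 1)
    (h1 : dist q z = t * dist q r) (h2 : dist z r = (1 - t) * dist q r) :
    dist p z ^ 2 ≤
      (1 - t) * dist p q ^ 2 + t * dist p r ^ 2 - t * (1 - t) * dist q r ^ 2 := by
  obtain ⟨γ, hγ⟩ := hX.1 q r
  rw [geod_unique hX q r z γ hγ t ht h1 h2]
  exact stewart_geod hX p q r γ hγ t ht

lemma pt_unique {X : Type*} [MetricSpace X] (hX : IsCAT0 X) (q r z w : X)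
    (t : ℝ) (ht : t ∈ Set.Icc (0:ℝ) 1)
    (h1 : dist q z = t * dist q r) (h2 : dist z r = (1 - t) * dist q r)
    (h3 : dist q w = t * dist q r) (h4 : dist w r = (1 - t) * dist q r) : z = w := by
  obtain ⟨γ, hγ⟩ := hX.1 q r
  rw [geod_unique hX q r z γ hγ t ht h1 h2, geod_unique hX q r w γ hγ t ht h3 h4]

/-- The plane. -/
abbrev Pl := EuclideanSpace ℝ (Fin 2)

lemma mem_tri (A D C p : Pl) : p ∈ convexHull ℝ ({A, D, C} : Set Pl) ↔
    ∃ u v : ℝ, 0 ≤ u ∧ 0 ≤ v ∧ u + v ≤ 1 ∧ p = D + u • (A - D) + v • (C - D) := by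
  rw [convexHull_insert (by simp), convexHull_pair]
  simp only [convexJoin_singleton_left, Set.mem_iUnion, segment, Set.mem_ofPred_eq, exists_prop]
  constructor
  · rintro ⟨y, ⟨a, b, ha, hb, hab, rfl⟩, c, e, hc, he, hce, rfl⟩
    refine ⟨c, e * b, hc, by positivity, by nlinarith, ?_⟩
    obtain rfl : a = 1 - b := by linarith
    obtain rfl : c = 1 - e := by linarith
    module
  · rintro ⟨u, v, hu, hv, huv, rfl⟩
    rcases eq_or_lt_of_le (show u ≤ 1 by linarith) with h | h
    · subst h
      obtain rfl : v = 0 := by linarith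
      exact ⟨D, ⟨1, 0, by simp, by simp, by simp, by simp⟩, 1, 0, by simp, by simp, by simp, by simp⟩
    · have h' : 0 < 1 - u := by linarith
      refine ⟨_, ⟨1 - v / (1 - u), v / (1 - u), ?_, by positivity, by ring, rfl⟩,
        u, 1 - u, hu, h'.le, by ring, ?_⟩
      · rw [sub_nonneg, div_le_one h']; linarith
      · have : v = (1 - u) * (v / (1 - u)) := by field_simp
        generalize v / (1 - u) = w at *
        subst this
        module

lemma tri_symm (A B C : Pl) : ({A, B, C} : Set Pl) = {B, A, C} := Set.insert_comm A B {C}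

lemma dist_pt (D A C : Pl) (u v u' v' : ℝ) :
    dist (D + u • (A - D) + v • (C - D)) (D + u' • (A - D) + v' • (C - D)) ^ 2 =
      (u - u') ^ 2 * dist A D ^ 2 + (v - v') ^ 2 * dist C D ^ 2 +
      (u - u') * (v - v') * (dist A D ^ 2 + dist C D ^ 2 - dist A C ^ 2) := by
  have e : dist A C ^ 2 = dist A D ^ 2 + dist C D ^ 2 - 2 * inner ℝ (A - D) (C - D) := by
    rw [dist_eq_norm A C, show A - C = (A - D) - (C - D) by abel, @norm_sub_sq ℝ, dist_eq_norm,
      dist_eq_norm]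
    simp only [RCLike.re_to_real]; ring
  rw [e, dist_eq_norm (D + u • (A - D) + v • (C - D)),
    show D + u • (A - D) + v • (C - D) - (D + u' • (A - D) + v' • (C - D)) =
      (u - u') • (A - D) + (v - v') • (C - D) by module, @norm_add_sq ℝ]
  simp only [norm_smul, inner_smul_left, inner_smul_right, mul_pow, Real.norm_eq_abs, sq_abs,
    dist_eq_norm, RCLike.re_to_real, RCLike.conj_to_real]
  ring

/-- A flat triangle may be parametrized by any planar triangle with the right sides. -/
lemma flat_transfer {X : Type*} [MetricSpace X] {a d c : X} (h : FlatTriangle a d c)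
    (A D C : Pl) (h1 : dist A D = dist a d) (h2 : dist C D = dist c d) (h3 : dist A C = dist a c) :
    ∃ φ : Pl → X, (∀ p ∈ convexHull ℝ ({A, D, C} : Set Pl),
      ∀ q ∈ convexHull ℝ ({A, D, C} : Set Pl), dist (φ p) (φ q) = dist p q) ∧
      φ A = a ∧ φ D = d ∧ φ C = c := by
  obtain ⟨A', D', C', φ, hφ, rfl, rfl, rfl⟩ := h
  have mA : A' ∈ convexHull ℝ ({A', D', C'} : Set Pl) := subset_convexHull _ _ (by simp)
  have mD : D' ∈ convexHull ℝ ({A', D', C'} : Set Pl) := subset_convexHull _ _ (by simp)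
  have mC : C' ∈ convexHull ℝ ({A', D', C'} : Set Pl) := subset_convexHull _ _ (by simp)
  rw [hφ _ mA _ mD] at h1
  rw [hφ _ mC _ mD] at h2
  rw [hφ _ mA _ mC] at h3
  have hex : ∀ p : Pl, ∃ x : X, ∀ u v : ℝ, 0 ≤ u → 0 ≤ v → u + v ≤ 1 →
      p = D + u • (A - D) + v • (C - D) → x = φ (D' + u • (A' - D') + v • (C' - D')) := by
    intro p
    by_cases hp : ∃ u v : ℝ, 0 ≤ u ∧ 0 ≤ v ∧ u + v ≤ 1 ∧ p = D + u • (A - D) + v • (C - D)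
    · obtain ⟨u, v, hu, hv, huv, rfl⟩ := hp
      refine ⟨φ (D' + u • (A' - D') + v • (C' - D')), fun u' v' hu' hv' huv' he => ?_⟩
      have := dist_pt D A C u v u' v'
      rw [← he, dist_self, h1, h2, h3, ← dist_pt] at this
      congr 1
      apply dist_eq_zero.1
      apply pow_eq_zero_iff two_ne_zero |>.1
      rw [← this]; norm_num
    · exact ⟨φ A', fun u v hu hv huv he => (hp ⟨u, v, hu, hv, huv, he⟩).elim⟩
  choose ψ hψ using hex
  refine ⟨ψ, ?_, ?_, ?_, ?_⟩
  · intro p hp q hq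
    obtain ⟨u, v, hu, hv, huv, rfl⟩ := (mem_tri _ _ _ _).1 hp
    obtain ⟨u', v', hu', hv', huv', rfl⟩ := (mem_tri _ _ _ _).1 hq
    rw [hψ _ u v hu hv huv rfl, hψ _ u' v' hu' hv' huv' rfl,
      hφ _ ((mem_tri _ _ _ _).2 ⟨u, v, hu, hv, huv, rfl⟩) _
        ((mem_tri _ _ _ _).2 ⟨u', v', hu', hv', huv', rfl⟩)]
    rw [← sq_eq_sq₀ dist_nonneg dist_nonneg, dist_pt, dist_pt, h1, h2, h3]
  · rw [hψ A 1 0 (by simp) (by simp) (by simp) (by simp)]; simp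
  · rw [hψ D 0 0 (by simp) (by simp) (by simp) (by simp)]; simp
  · rw [hψ C 0 1 (by simp) (by simp) (by simp) (by simp)]; simp

/-- Two triangles on both sides of `DC`: a segment joining them meets `DC`. -/
lemma crossing_aux (A D C B : Pl) (k : ℝ) (hk : 0 < k) (hB : B = D - k • (A - D)) (p q : Pl)
    (u v : ℝ) (hu : 0 ≤ u) (hv : 0 ≤ v) (huv : u + v ≤ 1)
    (hp : p = D + u • (A - D) + v • (C - D)) (hq : q ∈ convexHull ℝ ({B, D, C} : Set Pl)) :
    ∃ t ∈ Set.Icc (0:ℝ) 1, (0 < u → 0 < t) ∧ ∃ w ∈ Set.Icc (0:ℝ) 1,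
      p + t • (q - p) = D + w • (C - D) := by
  subst hp
  obtain ⟨u', v', hu', hv', huv', rfl⟩ := (mem_tri _ _ _ _).1 hq
  obtain ⟨t, ht0, ht1, hut, ht⟩ : ∃ t : ℝ, 0 ≤ t ∧ t ≤ 1 ∧ (0 < u → 0 < t) ∧ (1 - t) * u - t * (u' * k) = 0 := by
    have hk' : 0 ≤ u' * k := by positivity
    rcases (add_nonneg hu hk').eq_or_lt with h | h
    · exact ⟨0, le_rfl, by norm_num, fun _ => by linarith, by nlinarith⟩
    · refine ⟨u / (u + u' * k), by positivity, ?_, fun _ => by positivity, ?_⟩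
      · rw [div_le_one h]; linarith
      · field_simp; ring
  refine ⟨t, ⟨ht0, ht1⟩, hut, (1 - t) * v + t * v', ⟨?_, ?_⟩, ?_⟩
  · have : 0 ≤ 1 - t := by linarith
    positivity
  · nlinarith
  · subst hB
    have : D + u • (A - D) + v • (C - D) + t • (D + u' • (D - k • (A - D) - D) + v' • (C - D) -
      (D + u • (A - D) + v • (C - D))) =
      D + ((1 - t) * u - t * (u' * k)) • (A - D) + ((1 - t) * v + t * v') • (C - D) := by module
    rw [this, ht]; simp

lemma crossing (A D C B : Pl) (k : ℝ) (hk : 0 < k) (hB : B = D - k • (A - D)) (p q : Pl)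
    (hp : p ∈ convexHull ℝ ({A, D, C} : Set Pl)) (hq : q ∈ convexHull ℝ ({B, D, C} : Set Pl)) :
    ∃ t ∈ Set.Icc (0:ℝ) 1, ∃ w ∈ Set.Icc (0:ℝ) 1,
      p + t • (q - p) = D + w • (C - D) := by
  obtain ⟨u, v, hu, hv, huv, hp⟩ := (mem_tri _ _ _ _).1 hp
  obtain ⟨t, ht, -, w, hw, e⟩ := crossing_aux A D C B k hk hB p q u v hu hv huv hp hq
  exact ⟨t, ht, w, hw, e⟩

lemma cover (A D C B : Pl) (k : ℝ) (hk : 0 < k) (hB : B = D - k • (A - D)) (p : Pl)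
    (hp : p ∈ convexHull ℝ ({A, B, C} : Set Pl)) :
    p ∈ convexHull ℝ ({A, D, C} : Set Pl) ∨ p ∈ convexHull ℝ ({B, D, C} : Set Pl) := by
  obtain ⟨u, v, hu, hv, huv, rfl⟩ := (mem_tri _ _ _ _).1 hp
  subst hB
  have hb : 0 ≤ 1 - u - v := by linarith
  rcases le_total ((1 - u - v) * k) u with h | h
  · left
    refine (mem_tri _ _ _ _).2 ⟨u - (1 - u - v) * k, v, by linarith, hv, by nlinarith, by module⟩
  · right
    refine (mem_tri _ _ _ _).2 ⟨(1 - u - v) - u / k, v, ?_, hv, ?_, ?_⟩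
    · rw [sub_nonneg, div_le_iff₀ hk]; exact h
    · have : 0 ≤ u / k := by positivity
      linarith
    · have : u = u / k * k := by field_simp
      generalize u / k = w at *
      subst this
      module

lemma dist_seg_left (P Q : Pl) (t : ℝ) (ht : t ∈ Set.Icc (0:ℝ) 1) :
    dist P (P + t • (Q - P)) = t * dist P Q := by
  rw [dist_eq_norm, show P - (P + t • (Q - P)) = t • (P - Q) by module, norm_smul,
    Real.norm_eq_abs, abs_of_nonneg ht.1, dist_eq_norm]

lemma dist_seg_right (P Q : Pl) (t : ℝ) (ht : t ∈ Set.Icc (0:ℝ) 1) :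
    dist (P + t • (Q - P)) Q = (1 - t) * dist P Q := by
  rw [dist_eq_norm, show (P + t • (Q - P)) - Q = (1 - t) • (P - Q) by module, norm_smul,
    Real.norm_eq_abs, abs_of_nonneg (by linarith [ht.2]), dist_eq_norm]

/-- Euclidean Stewart identity. -/
lemma stewart_eucl (P Q R : Pl) (t : ℝ) :
    dist P (Q + t • (R - Q)) ^ 2 =
      (1 - t) * dist P Q ^ 2 + t * dist P R ^ 2 - t * (1 - t) * dist Q R ^ 2 := by
  have e1 : dist P R ^ 2 = dist P Q ^ 2 + dist Q R ^ 2 - 2 * inner ℝ (P - Q) (R - Q) := by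
    rw [dist_comm Q R, dist_eq_norm P R, show P - R = (P - Q) - (R - Q) by abel,
      @norm_sub_sq ℝ, dist_eq_norm, dist_eq_norm]
    simp only [RCLike.re_to_real]; ring
  rw [e1, dist_comm Q R, dist_eq_norm P (Q + _),
    show P - (Q + t • (R - Q)) = (P - Q) - t • (R - Q) by module, @norm_sub_sq ℝ]
  simp only [norm_smul, inner_smul_right, mul_pow, Real.norm_eq_abs, sq_abs,
    dist_eq_norm, RCLike.re_to_real]
  ring

/-- Lower bound step: if `z` is on the segment from `q` to `r` and all distances but
`d(x,r)` are Euclidean, then `d(x,r)` is at least Euclidean. -/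
lemma lower {X : Type*} [MetricSpace X] (hX : IsCAT0 X) (x q r z : X) (P Q R : Pl)
    (t : ℝ) (ht : t ∈ Set.Icc (0:ℝ) 1) (ht0 : 0 < t)
    (hqz : dist q z = dist Q (Q + t • (R - Q))) (hzr : dist z r = dist (Q + t • (R - Q)) R)
    (hqr : dist q r = dist Q R) (hxq : dist x q = dist P Q)
    (hxz : dist x z = dist P (Q + t • (R - Q))) : dist P R ≤ dist x r := by
  have h := stewart hX x q r z t ht (by rw [hqz, hqr, dist_seg_left _ _ _ ht])
    (by rw [hzr, hqr, dist_seg_right _ _ _ ht])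
  rw [hxz, stewart_eucl, hxq, hqr] at h
  have h2 : t * dist P R ^ 2 ≤ t * dist x r ^ 2 := by linarith
  exact (sq_le_sq₀ dist_nonneg dist_nonneg).1 (le_of_mul_le_mul_left h2 ht0)

lemma compAngle_nonneg {X : Type*} [MetricSpace X] (x p q : X) : 0 ≤ compAngle x p q :=
  Real.arccos_nonneg _

lemma alexAngle_eq {X : Type*} [MetricSpace X] (x : X) (γ σ : ℝ → X) (δ θ : ℝ) (hδ : 0 < δ)
    (hθ : 0 ≤ θ)
    (h : ∀ s ∈ Set.Ioc (0:ℝ) δ, ∀ t ∈ Set.Ioc (0:ℝ) δ, compAngle x (γ s) (σ t) = θ) :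
    alexAngle x γ σ = θ := by
  have hpi : ∀ y z : X, compAngle x y z ≤ π := fun y z => Real.arccos_le_pi _
  have b0 : ∀ (ε s t : ℝ), (⨆ (_ : t ∈ Set.Ioc (0:ℝ) ε), compAngle x (γ s) (σ t)) ≤ π := by
    intro ε s t
    exact Real.iSup_le (fun _ => hpi _ _) Real.pi_nonneg
  have b1 : ∀ (ε s : ℝ), (⨆ t ∈ Set.Ioc (0:ℝ) ε, compAngle x (γ s) (σ t)) ≤ π := by
    intro ε s
    exact Real.iSup_le (fun _ => b0 _ _ _) Real.pi_nonneg
  have b2 : ∀ (ε s : ℝ), (⨆ (_ : s ∈ Set.Ioc (0:ℝ) ε), ⨆ t ∈ Set.Ioc (0:ℝ) ε,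
      compAngle x (γ s) (σ t)) ≤ π := by
    intro ε s
    exact Real.iSup_le (fun _ => b1 _ _) Real.pi_nonneg
  unfold alexAngle
  apply le_antisymm
  · refine ciInf_le_of_le ⟨0, ?_⟩ ⟨δ, hδ⟩ ?_
    · rintro _ ⟨ε, rfl⟩
      exact Real.iSup_nonneg fun s => Real.iSup_nonneg fun _ => Real.iSup_nonneg fun t =>
        Real.iSup_nonneg fun _ => compAngle_nonneg _ _ _
    · exact Real.iSup_le (fun s => Real.iSup_le (fun hs => Real.iSup_le (fun t =>
        Real.iSup_le (fun ht => (h s hs t ht).le) hθ) hθ) hθ) hθ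
  · have : Nonempty {ε : ℝ // 0 < ε} := ⟨⟨1, one_pos⟩⟩
    refine le_ciInf ?_
    rintro ⟨ε, hε⟩
    have hm : 0 < min ε δ := lt_min hε hδ
    have hs : min ε δ ∈ Set.Ioc (0:ℝ) ε := ⟨hm, min_le_left _ _⟩
    have hs' : min ε δ ∈ Set.Ioc (0:ℝ) δ := ⟨hm, min_le_right _ _⟩
    refine le_ciSup_of_le ⟨π, ?_⟩ (min ε δ) ?_
    · rintro _ ⟨s, rfl⟩; exact b2 _ _
    rw [ciSup_pos hs]
    refine le_ciSup_of_le ⟨π, ?_⟩ (min ε δ) ?_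
    · rintro _ ⟨s, rfl⟩; exact b0 _ _ _
    rw [ciSup_pos hs]
    exact (h _ hs' _ hs').ge

/-- In a flat triangle the Alexandrov angle is the comparison angle. -/
lemma flat_angle {X : Type*} [MetricSpace X] (hX : IsCAT0 X) (a c d : X)
    (h : FlatTriangle a d c) (hda : 0 < dist d a) (hdc : 0 < dist d c) (γ σ : ℝ → X)
    (hγ : IsGeodesicSeg γ 0 (dist d a) d a) (hσ : IsGeodesicSeg σ 0 (dist d c) d c) :
    alexAngle d γ σ = compAngle d a c := by
  obtain ⟨A, D, C, φ, hφ, rfl, rfl, rfl⟩ := h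
  have mA : A ∈ convexHull ℝ ({A, D, C} : Set Pl) := subset_convexHull _ _ (by simp)
  have mD : D ∈ convexHull ℝ ({A, D, C} : Set Pl) := subset_convexHull _ _ (by simp)
  have mC : C ∈ convexHull ℝ ({A, D, C} : Set Pl) := subset_convexHull _ _ (by simp)
  have eA := hφ _ mD _ mA
  have eC := hφ _ mD _ mC
  have eAC := hφ _ mA _ mC
  refine alexAngle_eq _ _ _ (min (dist (φ D) (φ A)) (dist (φ D) (φ C))) _ (lt_min hda hdc)
    (compAngle_nonneg _ _ _) ?_
  intro s hs t ht
  have hs1 : s ≤ dist (φ D) (φ A) := hs.2.trans (min_le_left _ _)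
  have ht1 : t ≤ dist (φ D) (φ C) := ht.2.trans (min_le_right _ _)
  obtain ⟨u, hu⟩ : ∃ u, u = s / dist (φ D) (φ A) := ⟨_, rfl⟩
  obtain ⟨v, hv⟩ : ∃ v, v = t / dist (φ D) (φ C) := ⟨_, rfl⟩
  have hu' : s = u * dist (φ D) (φ A) := by rw [hu]; field_simp
  have hv' : t = v * dist (φ D) (φ C) := by rw [hv]; field_simp
  have u0 : 0 < u := hu ▸ div_pos hs.1 hda
  have v0 : 0 < v := hv ▸ div_pos ht.1 hdc
  have u1 : u ∈ Set.Icc (0:ℝ) 1 := ⟨u0.le, by rw [hu]; exact (div_le_one hda).2 hs1⟩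
  have v1 : v ∈ Set.Icc (0:ℝ) 1 := ⟨v0.le, by rw [hv]; exact (div_le_one hdc).2 ht1⟩
  have mU : D + u • (A - D) ∈ convexHull ℝ ({A, D, C} : Set Pl) :=
    (mem_tri _ _ _ _).2 ⟨u, 0, u1.1, le_rfl, by linarith [u1.2], by simp⟩
  have mV : D + v • (C - D) ∈ convexHull ℝ ({A, D, C} : Set Pl) :=
    (mem_tri _ _ _ _).2 ⟨0, v, le_rfl, v1.1, by linarith [v1.2], by simp⟩
  have gU : φ (D + u • (A - D)) = γ s := by
    rw [hu']
    refine geod_unique hX _ _ _ γ hγ u u1 ?_ ?_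
    · rw [hφ _ mD _ mU, eA, dist_seg_left _ _ _ u1]
    · rw [hφ _ mU _ mA, eA, dist_seg_right _ _ _ u1]
  have gV : φ (D + v • (C - D)) = σ t := by
    rw [hv']
    refine geod_unique hX _ _ _ σ hσ v v1 ?_ ?_
    · rw [hφ _ mD _ mV, eC, dist_seg_left _ _ _ v1]
    · rw [hφ _ mV _ mC, eC, dist_seg_right _ _ _ v1]
  rw [← gU, ← gV]
  unfold compAngle
  rw [hφ _ mD _ mU, hφ _ mD _ mV, hφ _ mU _ mV, dist_seg_left _ _ _ u1, dist_seg_left _ _ _ v1,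
    eA, eC, eAC]
  have := dist_pt D A C u 0 0 v
  simp only [zero_smul, add_zero] at this
  rw [this]
  rw [eA] at hda
  rw [eC] at hdc
  rw [dist_comm A D, dist_comm C D]
  congr 1
  field_simp
  ring

lemma cos_bound {X : Type*} [MetricSpace X] (x p q : X) (hp : 0 < dist x p) (hq : 0 < dist x q) :
    (dist x p ^ 2 + dist x q ^ 2 - dist p q ^ 2) / (2 * dist x p * dist x q) ∈
      Set.Icc (-1:ℝ) 1 := by
  have h1 := dist_triangle_left p q x
  have h2 := dist_triangle x p q
  have h3 := dist_triangle_right x p q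
  rw [dist_comm p q] at *
  have h0 : 0 ≤ dist q p := dist_nonneg
  have hpos : 0 < 2 * dist x p * dist x q := by positivity
  constructor
  · rw [le_div_iff₀ hpos]; nlinarith
  · rw [div_le_iff₀ hpos]
    have : dist x q ≤ dist x p + dist q p := h2
    nlinarith

lemma flat_swap {X : Type*} [MetricSpace X] {a b c : X} (h : FlatTriangle a b c) :
    FlatTriangle b a c := by
  obtain ⟨A, B, C, φ, hφ, h1, h2, h3⟩ := h
  refine ⟨B, A, C, φ, ?_, h2, h1, h3⟩
  rw [tri_symm B A C]
  exact hφ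

/-- Half of the key step: distances from the first triangle to the vertex `b`. -/
lemma to_vertex {X : Type*} [MetricSpace X] (hX : IsCAT0 X) (A D C B : Pl) (k : ℝ) (hk : 0 < k)
    (hB : B = D - k • (A - D)) (φ ψ : Pl → X)
    (hφ : ∀ p ∈ convexHull ℝ ({A, D, C} : Set Pl),
      ∀ q ∈ convexHull ℝ ({A, D, C} : Set Pl), dist (φ p) (φ q) = dist p q)
    (hD : φ D = ψ D) (hBD : dist (ψ D) (ψ B) = dist D B)
    (hAB : dist (φ A) (ψ B) = dist A B) (p : Pl)
    (hp : p ∈ convexHull ℝ ({A, D, C} : Set Pl)) : dist p B ≤ dist (φ p) (ψ B) := by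
  have mA : A ∈ convexHull ℝ ({A, D, C} : Set Pl) := subset_convexHull _ _ (by simp)
  have mD : D ∈ convexHull ℝ ({A, D, C} : Set Pl) := subset_convexHull _ _ (by simp)
  have hk1 : 0 < 1 + k := by linarith
  have eD : A + (1 / (1 + k)) • (B - A) = D := by
    rw [hB, show D - k • (A - D) - A = (1 + k) • (D - A) by module, smul_smul,
      one_div_mul_cancel hk1.ne', one_smul]
    abel
  refine lower hX (φ p) (φ A) (ψ B) (φ D) p A B (1 / (1 + k))
    ⟨by positivity, by rw [div_le_one hk1]; linarith⟩ (by positivity) ?_ ?_ hAB ?_ ?_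
  · rw [eD, hφ _ mA _ mD]
  · rw [eD, hD, hBD]
  · rw [hφ _ hp _ mA]
  · rw [eD, hφ _ hp _ mD]

/-- (Lemma 5.5) In a CAT(0) space, if `d` lies on the segment `ab`, the
triangles `Δ(a,d,c)` and `Δ(b,d,c)` are Euclidean, and the Alexandrov angles at `d`
satisfy `∠_d(da,dc) + ∠_d(db,dc) = π`, then `Δ(a,b,c)` is Euclidean. -/
theorem flat_triangle_gluing
    {X : Type*} [MetricSpace X] (hX : IsCAT0 X) (a b c d : X)
    (γab : ℝ → X) (hab : IsGeodesicSeg γab 0 (dist a b) a b)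
    (s : ℝ) (hs : s ∈ Set.Icc 0 (dist a b)) (hd : γab s = d)
    (h1 : FlatTriangle a d c) (h2 : FlatTriangle b d c)
    (γda γdb γdc : ℝ → X)
    (hda : IsGeodesicSeg γda 0 (dist d a) d a)
    (hdb : IsGeodesicSeg γdb 0 (dist d b) d b)
    (hdc : IsGeodesicSeg γdc 0 (dist d c) d c)
    (hang : alexAngle d γda γdc + alexAngle d γdb γdc = π) :
    FlatTriangle a b c := by
  by_cases ea : d = a
  · subst ea; exact flat_swap h2
  by_cases eb : d = b
  · subst eb; exact h1
  by_cases ec : d = c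
  · -- degenerate case: the triangle is the segment `ab`
    subst ec
    obtain ⟨hg, g0, g1⟩ := hab
    have hL : 0 < dist a b := by
      rcases (dist_nonneg (x := a) (y := b)).eq_or_lt with h | h
      · exfalso
        rw [← h] at hs
        have : s = 0 := le_antisymm hs.2 hs.1
        rw [this, g0] at hd
        exact ea hd.symm
      · exact h
    have hcoord : ∀ p ∈ convexHull ℝ
        ({!₂[0, 0], !₂[dist a b, 0], !₂[s, 0]} : Set Pl), p 0 ∈ Set.Icc 0 (dist a b) ∧ p 1 = 0 := by
      intro p hp
      obtain ⟨u, v, hu, hv, huv, rfl⟩ := (mem_tri _ _ _ _).1 hp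
      have := hs.1
      have := hs.2
      simp
      constructor <;> nlinarith
    refine ⟨!₂[0, 0], !₂[dist a b, 0], !₂[s, 0], fun p => γab (p 0), ?_, ?_, ?_, ?_⟩
    · intro p hp q hq
      obtain ⟨p0, p1⟩ := hcoord p hp
      obtain ⟨q0, q1⟩ := hcoord q hq
      rw [hg _ p0 _ q0, EuclideanSpace.dist_eq]
      simp [p1, q1, Real.dist_eq, Real.sqrt_sq_eq_abs]
    · simpa using g0
    · simpa using g1
    · simpa using hd
  have pa : 0 < dist d a := dist_pos.2 ea
  have pb : 0 < dist d b := dist_pos.2 eb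
  have pc : 0 < dist d c := dist_pos.2 ec
  rw [flat_angle hX a c d h1 pa pc γda γdc hda hdc,
    flat_angle hX b c d h2 pb pc γdb γdc hdb hdc] at hang
  have hcos : (dist d b ^ 2 + dist d c ^ 2 - dist b c ^ 2) / (2 * dist d b * dist d c) =
      -((dist d a ^ 2 + dist d c ^ 2 - dist a c ^ 2) / (2 * dist d a * dist d c)) := by
    have b1 := cos_bound d a c pa pc
    have b2 := cos_bound d b c pb pc
    unfold compAngle at hang
    refine Real.arccos_injOn b2 ⟨by linarith [b1.2], by linarith [b1.1]⟩ ?_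
    rw [Real.arccos_neg]; linarith
  have hadb : dist a b = dist d a + dist d b := by
    obtain ⟨hg, g0, g1⟩ := hab
    have e1 := hg 0 ⟨le_rfl, dist_nonneg⟩ s hs
    have e2 := hg s hs (dist a b) ⟨dist_nonneg, le_rfl⟩
    rw [g0, hd, zero_sub, abs_neg, abs_of_nonneg hs.1] at e1
    rw [g1, hd, abs_of_nonpos (by linarith [hs.2])] at e2
    rw [dist_comm d a]; linarith
  obtain ⟨A, D, C, φ, hφ, fA, fD, fC⟩ := h1
  have mA : A ∈ convexHull ℝ ({A, D, C} : Set Pl) := subset_convexHull _ _ (by simp)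
  have mD : D ∈ convexHull ℝ ({A, D, C} : Set Pl) := subset_convexHull _ _ (by simp)
  have mC : C ∈ convexHull ℝ ({A, D, C} : Set Pl) := subset_convexHull _ _ (by simp)
  have eAD : dist A D = dist d a := by rw [← hφ _ mA _ mD, fA, fD, dist_comm]
  have eCD : dist C D = dist d c := by rw [← hφ _ mC _ mD, fC, fD, dist_comm]
  have eAC : dist A C = dist a c := by rw [← hφ _ mA _ mC, fA, fC]
  obtain ⟨k, hkdef⟩ : ∃ k, k = dist d b / dist d a := ⟨_, rfl⟩
  have hk : 0 < k := hkdef ▸ div_pos pb pa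
  have hkda : k * dist d a = dist d b := by rw [hkdef]; field_simp
  obtain ⟨B, hB⟩ : ∃ B : Pl, B = D - k • (A - D) := ⟨_, rfl⟩
  have eBD : dist B D = dist d b := by
    rw [hB, dist_eq_norm, show D - k • (A - D) - D = (-k) • (A - D) by module, norm_smul,
      ← dist_eq_norm, eAD, Real.norm_eq_abs, abs_neg, abs_of_pos hk, hkda]
  have eAB : dist A B = dist a b := by
    rw [hB, dist_eq_norm, show A - (D - k • (A - D)) = (1 + k) • (A - D) by module, norm_smul,
      ← dist_eq_norm, eAD, Real.norm_eq_abs, abs_of_pos (by linarith), hadb]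
    linarith
  have eBC : dist B C = dist b c := by
    rw [← sq_eq_sq₀ dist_nonneg dist_nonneg]
    have := dist_pt D A C (-k) 0 0 1
    rw [show D + (-k) • (A - D) + (0:ℝ) • (C - D) = B by rw [hB]; module,
      show D + (0:ℝ) • (A - D) + (1:ℝ) • (C - D) = C by module, eAD, eCD, eAC] at this
    rw [this, hkdef]
    field_simp at hcos ⊢
    linarith
  obtain ⟨ψ, hψ, gB, gD, gC⟩ := flat_transfer h2 B D C (by rw [eBD, dist_comm])
    (by rw [eCD, dist_comm]) eBC
  have nB : B ∈ convexHull ℝ ({B, D, C} : Set Pl) := subset_convexHull _ _ (by simp)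
  have nD : D ∈ convexHull ℝ ({B, D, C} : Set Pl) := subset_convexHull _ _ (by simp)
  have nC : C ∈ convexHull ℝ ({B, D, C} : Set Pl) := subset_convexHull _ _ (by simp)
  have hA : A = D - k⁻¹ • (B - D) := by
    rw [hB, show D - k • (A - D) - D = (-k) • (A - D) by module, smul_smul,
      show k⁻¹ * -k = -1 by field_simp]
    module
  -- the two maps agree on `DC`
  have mseg : ∀ w ∈ Set.Icc (0:ℝ) 1, D + w • (C - D) ∈ convexHull ℝ ({A, D, C} : Set Pl) :=
    fun w hw => (mem_tri _ _ _ _).2 ⟨0, w, le_rfl, hw.1, by linarith [hw.2], by simp⟩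
  have nseg : ∀ w ∈ Set.Icc (0:ℝ) 1, D + w • (C - D) ∈ convexHull ℝ ({B, D, C} : Set Pl) :=
    fun w hw => (mem_tri _ _ _ _).2 ⟨0, w, le_rfl, hw.1, by linarith [hw.2], by simp⟩
  have agree : ∀ w ∈ Set.Icc (0:ℝ) 1, φ (D + w • (C - D)) = ψ (D + w • (C - D)) := by
    intro w hw
    have e : dist d c = dist D C := by rw [← eCD, dist_comm]
    refine pt_unique hX d c _ _ w hw ?_ ?_ ?_ ?_
    · rw [← fD, hφ _ mD _ (mseg w hw), dist_seg_left _ _ _ hw, fD, e]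
    · rw [← fC, hφ _ (mseg w hw) _ mC, dist_seg_right _ _ _ hw, fC, e]
    · rw [← gD, hψ _ nD _ (nseg w hw), dist_seg_left _ _ _ hw, gD, e]
    · rw [← gC, hψ _ (nseg w hw) _ nC, dist_seg_right _ _ _ hw, gC, e]
  -- upper bound
  have upper : ∀ p ∈ convexHull ℝ ({A, D, C} : Set Pl), ∀ q ∈ convexHull ℝ ({B, D, C} : Set Pl),
      dist (φ p) (ψ q) ≤ dist p q := by
    intro p hp q hq
    obtain ⟨t, ht, w, hw, e⟩ := crossing A D C B k hk hB p q hp hq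
    have i1 := hφ p hp _ (mseg w hw)
    have i2 := hψ _ (nseg w hw) q hq
    rw [← e, dist_seg_left _ _ _ ht, e] at i1
    rw [← e, dist_seg_right _ _ _ ht, e, ← agree w hw] at i2
    have := dist_triangle (φ p) (φ (D + w • (C - D))) (ψ q)
    linarith
  have qa : ∀ q ∈ convexHull ℝ ({B, D, C} : Set Pl), dist (ψ q) (φ A) = dist q A := by
    intro q hq
    apply le_antisymm
    · rw [dist_comm, dist_comm q]; exact upper A mA q hq
    · refine to_vertex hX B D C A k⁻¹ (inv_pos.2 hk) hA ψ φ hψ (by rw [gD, fD]) ?_ ?_ q hq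
      · rw [hφ _ mD _ mA]
      · rw [gB, fA, dist_comm, ← eAB, dist_comm]
  have cross : ∀ p ∈ convexHull ℝ ({A, D, C} : Set Pl), ∀ q ∈ convexHull ℝ ({B, D, C} : Set Pl),
      dist (φ p) (ψ q) = dist p q := by
    intro p hp q hq
    apply le_antisymm (upper p hp q hq)
    obtain ⟨t, ht, h, w, hw, e⟩ := crossing_aux A D C B k hk hB A q 1 0 zero_le_one le_rfl
      (by norm_num) (by simp) hq
    · refine lower hX (φ p) (φ A) (ψ q) (φ (D + w • (C - D))) p A q t ht (h one_pos) ?_ ?_ ?_ ?_ ?_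
      · rw [e, hφ _ mA _ (mseg w hw)]
      · rw [e, agree w hw, hψ _ (nseg w hw) _ hq]
      · rw [dist_comm, qa q hq, dist_comm]
      · exact hφ _ hp _ mA
      · rw [e, hφ _ hp _ (mseg w hw)]
  classical
  have hφ' : ∀ p ∈ convexHull ℝ ({B, D, C} : Set Pl),
      (if p ∈ convexHull ℝ ({A, D, C} : Set Pl) then φ p else ψ p) = ψ p := by
    intro p hp
    split_ifs with h
    · exact dist_eq_zero.1 (by rw [cross p h p hp, dist_self])
    · rfl
  have hφ'' : ∀ p ∈ convexHull ℝ ({A, D, C} : Set Pl),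
      (if p ∈ convexHull ℝ ({A, D, C} : Set Pl) then φ p else ψ p) = φ p := by
    intro p hp
    rw [if_pos hp]
  refine ⟨A, B, C, fun p => if p ∈ convexHull ℝ ({A, D, C} : Set Pl) then φ p else ψ p,
    ?_, ?_, ?_, ?_⟩
  · intro p hp q hq
    simp only
    rcases cover A D C B k hk hB p hp with h | h <;> rcases cover A D C B k hk hB q hq with h' | h'
    · rw [hφ'' p h, hφ'' q h', hφ p h q h']
    · rw [hφ'' p h, hφ' q h', cross p h q h']
    · rw [hφ' p h, hφ'' q h', dist_comm, cross q h' p h, dist_comm]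
    · rw [hφ' p h, hφ' q h', hψ p h q h']
  · exact (hφ'' A mA).trans fA
  · exact (hφ' B nB).trans gB
  · exact (hφ'' C mC).trans fC
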